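/- Let Q ⊂ ℝⁿ (n ≥ 2) be a cube, and let 1 ≤ p < n and p ≤ q ≤ p* := np/(n−p). There is a constant C(n), depending only on the dimension n, such that for every locally Lipschitz f ∈ L¹(Q), (∫_Q |f(x) − f_Q|^q dx)^{1/q} ≤ C(n) · q · |Q|^{1/n + 1/q − 1/p} (∫_Q |∇f(x)|^p dx)^{1/p}, where f_Q = |Q|^{-1}∫_Q f dx and ∇f is the a.e.-defined gradient of f. -/

import Mathlib

open MeasureTheory Metric Set Filter Topology

noncomputable section

abbrev Eucl (n : ℕ) : Type := EuclideanSpace ℝ (Fin n)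

/-- Essential supremum of `p` over the set `A` (w.r.t. Lebesgue measure). -/
def essSupOn {n : ℕ} (p : Eucl n → ℝ) (A : Set (Eucl n)) : ℝ :=
  essSup p (volume.restrict A)

/-- Essential infimum of `p` over the set `A` (w.r.t. Lebesgue measure). -/
def essInfOn {n : ℕ} (p : Eucl n → ℝ) (A : Set (Eucl n)) : ℝ :=
  essInf p (volume.restrict A)

/-- The Luxemburg norm of `f` on `A` with variable exponent `p`. -/
def luxNorm {n : ℕ} (A : Set (Eucl n)) (p f : Eucl n → ℝ) : ℝ :=
  sInf {l : ℝ | 0 < l ∧ (∫⁻ x in A, ENNReal.ofReal ((|f x| / l) ^ (p x))) ≤ 1}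

/-- `f` belongs to the variable Lebesgue space `L^{p(·)}(A)`. -/
def MemVarLp {n : ℕ} (A : Set (Eucl n)) (p f : Eucl n → ℝ) : Prop :=
  ∃ l : ℝ, 0 < l ∧ (∫⁻ x in A, ENNReal.ofReal ((|f x| / l) ^ (p x))) ≤ 1

/-- `d(x) = dist(x, ∂Ω)`. -/
def bdist {n : ℕ} (Ω : Set (Eucl n)) (x : Eucl n) : ℝ :=
  infDist x (frontier Ω)

/-- The ball `B_{x,τ} = B(x, τ d(x))`. -/
def ballB {n : ℕ} (Ω : Set (Eucl n)) (τ : ℝ) (x : Eucl n) : Set (Eucl n) :=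
  ball x (τ * bdist Ω x)

/-- The boundary log-Hölder condition `∂LH₀^τ(Ω)` with constant `C₀`. -/
def BoundaryLH {n : ℕ} (Ω : Set (Eucl n)) (p : Eucl n → ℝ) (τ C₀ : ℝ) : Prop :=
  ∀ x ∈ Ω, τ * bdist Ω x ≤ 1 / 2 →
    essSupOn p (ballB Ω τ x ∩ Ω) - essInfOn p (ballB Ω τ x ∩ Ω)
      ≤ C₀ / (-Real.log (τ * bdist Ω x))

/-- `Ω` is a John domain with parameter `lam`. -/
def JohnDomain {n : ℕ} (Ω : Set (Eucl n)) (lam : ℝ) : Prop :=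
  ∃ x₀ ∈ Ω, ∀ y ∈ Ω, ∃ ℓ : ℝ, 0 ≤ ℓ ∧ ∃ γ : ℝ → Eucl n,
    γ 0 = y ∧ γ ℓ = x₀ ∧ (∀ t ∈ Icc (0:ℝ) ℓ, γ t ∈ Ω) ∧
    LipschitzOnWith 1 γ (Icc (0:ℝ) ℓ) ∧
    ∀ t ∈ Icc (0:ℝ) ℓ, t ≤ lam * infDist (γ t) (frontier Ω)

/-- `g` is uniformly `ε`-continuous on `S`. -/
def UnifEpsCont {n : ℕ} (S : Set (Eucl n)) (g : Eucl n → ℝ) (ε : ℝ) : Prop :=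
  ∃ δ : ℝ, 0 < δ ∧ ∀ x ∈ S, ∀ y ∈ S, dist x y < δ → |g y - g x| < ε

/-- `f` is locally Lipschitz on `S`. -/
def LocLipschitzOn {n : ℕ} (S : Set (Eucl n)) (f : Eucl n → ℝ) : Prop :=
  ∀ x ∈ S, ∃ K : NNReal, ∃ t ∈ 𝓝 x, LipschitzOnWith K f (t ∩ S)

/-- The average of `f` over `A`. -/
def avgOn {n : ℕ} (A : Set (Eucl n)) (f : Eucl n → ℝ) : ℝ :=
  (volume A).toReal⁻¹ * ∫ x in A, f x

/-- The pointwise dual (conjugate) exponent `p'`, `1/p + 1/p' = 1`. -/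
def dualExp {α : Type*} (p : α → ℝ) : α → ℝ :=
  fun x => p x / (p x - 1)

/-- The norm of the a.e.-defined gradient of `f`. -/
def gradNorm {n : ℕ} (f : Eucl n → ℝ) : Eucl n → ℝ :=
  fun x => ‖fderiv ℝ f x‖

/-- The closed cube with center `c` and half side length `r`. -/
def closedCube {n : ℕ} (c : Eucl n) (r : ℝ) : Set (Eucl n) :=
  {x | ∀ i, |x i - c i| ≤ r}

open scoped ENNReal NNReal

/-- The norm of the derivative of `f` where `f` is differentiable, and `K` elsewhere. If `f` is
`K`-Lipschitz, this is an upper gradient of `f` along every segment. -/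
def upperGrad {E : Type*} [NormedAddCommGroup E] [NormedSpace ℝ E] (K : ℝ≥0) (f : E → ℝ)
    (x : E) : ℝ≥0∞ :=
  open Classical in if DifferentiableAt ℝ f x then ‖fderiv ℝ f x‖ₑ else K

section UpperGrad

variable {E : Type*} [NormedAddCommGroup E] [NormedSpace ℝ E]

theorem measurable_upperGrad [MeasurableSpace E] [BorelSpace E] (K : ℝ≥0)
    (f : E → ℝ) : Measurable (upperGrad K f) := by
  classical
  unfold upperGrad
  refine Measurable.ite (measurableSet_of_differentiableAt ℝ f) ?_ measurable_const
  exact (measurable_fderiv ℝ f).enorm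

theorem upperGrad_ae_eq [MeasurableSpace E] [BorelSpace E] [FiniteDimensional ℝ E]
    (μ : Measure E) [μ.IsAddHaarMeasure] {K : ℝ≥0} {f : E → ℝ} (hf : LipschitzWith K f) :
    upperGrad K f =ᵐ[μ] fun x => ‖fderiv ℝ f x‖ₑ := by
  filter_upwards [hf.ae_differentiableAt (μ := μ)] with x hx
  simp [upperGrad, hx]

theorem lipschitzWith_comp_line {K : ℝ≥0} {f : E → ℝ} (hf : LipschitzWith K f) (z v : E) :
    LipschitzWith (K * ‖v‖₊) (fun t : ℝ => f (z + t • v)) := by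
  refine hf.comp (LipschitzWith.of_dist_le_mul fun s t => ?_)
  rw [dist_add_left, dist_eq_norm, ← sub_smul, norm_smul, mul_comm, Real.dist_eq, Real.norm_eq_abs,
    coe_nnnorm]

theorem enorm_deriv_line_le {K : ℝ≥0} {f : E → ℝ} (hf : LipschitzWith K f) (z v : E) (t : ℝ) :
    ‖deriv (fun t : ℝ => f (z + t • v)) t‖ₑ ≤ upperGrad K f (z + t • v) * ‖v‖ₑ := by
  unfold upperGrad
  split_ifs with h
  · have h1 : HasDerivAt (fun t : ℝ => z + t • v) v t := by
      simpa using ((hasDerivAt_id t).smul_const v).const_add z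
    have h2 := h.hasFDerivAt.comp_hasDerivAt t h1
    have h3 : deriv (fun t : ℝ => f (z + t • v)) t = fderiv ℝ f (z + t • v) v := h2.deriv
    rw [h3]
    exact ContinuousLinearMap.le_opENorm _ _
  · have h1 := norm_deriv_le_of_lipschitz (x₀ := t) (lipschitzWith_comp_line hf z v)
    rw [← ofReal_norm]
    refine (ENNReal.ofReal_le_ofReal h1).trans (le_of_eq ?_)
    rw [ENNReal.ofReal_coe_nnreal, ENNReal.coe_mul, enorm_eq_nnnorm]

end UpperGrad

section OneDimensional

theorem LocallyLipschitz.enorm_sub_le_lintegral_deriv {h : ℝ → ℝ} (hh : LocallyLipschitz h)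
    {a b x y : ℝ} (hx : x ∈ Icc a b) (hy : y ∈ Icc a b) :
    ‖h x - h y‖ₑ ≤ ∫⁻ t in Icc a b, ‖deriv h t‖ₑ := by
  obtain ⟨K, hK⟩ := LocallyLipschitzOn.exists_lipschitzOnWith_of_compact
    (isCompact_uIcc (a := y) (b := x)) hh.locallyLipschitzOn
  rw [← hK.absolutelyContinuousOnInterval.integral_deriv_eq_sub,
    intervalIntegral.intervalIntegral_eq_integral_uIoc]
  have h1 : ‖(if y ≤ x then (1:ℝ) else -1) • ∫ t in uIoc y x, deriv h t‖ₑ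
      = ‖∫ t in uIoc y x, deriv h t‖ₑ := by
    split_ifs <;> simp
  rw [h1]
  refine (enorm_integral_le_lintegral_enorm _).trans (lintegral_mono_set ?_)
  exact uIoc_subset_uIcc.trans (uIcc_subset_Icc hy hx)

theorem LocallyLipschitz.enorm_le_lintegral {h : ℝ → ℝ} (hh : LocallyLipschitz h)
    {a b x : ℝ} (hab : a < b) (hx : x ∈ Icc a b) :
    ‖h x‖ₑ ≤ ∫⁻ t in Icc a b, ((ENNReal.ofReal (b - a))⁻¹ * ‖h t‖ₑ + ‖deriv h t‖ₑ) := by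
  have hℓ0 : ENNReal.ofReal (b - a) ≠ 0 := by simpa using hab
  have hm : Measurable fun t => ‖h t‖ₑ := hh.continuous.measurable.enorm
  rw [lintegral_add_left (hm.const_mul _), lintegral_const_mul _ hm]
  have key : ENNReal.ofReal (b - a) * ‖h x‖ₑ ≤
      (∫⁻ t in Icc a b, ‖h t‖ₑ) + ENNReal.ofReal (b - a) * ∫⁻ t in Icc a b, ‖deriv h t‖ₑ := by
    calc ENNReal.ofReal (b - a) * ‖h x‖ₑ = ∫⁻ y in Icc a b, ‖h x‖ₑ := by
          simp [mul_comm]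
      _ ≤ ∫⁻ y in Icc a b, (‖h y‖ₑ + ∫⁻ t in Icc a b, ‖deriv h t‖ₑ) := by
          refine setLIntegral_mono' measurableSet_Icc fun y hy => ?_
          have : h x = h y + (h x - h y) := by ring
          rw [this]
          refine (enorm_add_le _ _).trans ?_
          gcongr
          exact hh.enorm_sub_le_lintegral_deriv hx hy
      _ = _ := by
          rw [lintegral_add_left hm]
          simp [mul_comm]
  calc ‖h x‖ₑ = (ENNReal.ofReal (b - a))⁻¹ * (ENNReal.ofReal (b - a) * ‖h x‖ₑ) := by
        rw [← mul_assoc, ENNReal.inv_mul_cancel hℓ0 ENNReal.ofReal_ne_top, one_mul]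
    _ ≤ _ := mul_le_mul_right key _
    _ = _ := by
        rw [mul_add, ← mul_assoc _ (ENNReal.ofReal (b - a)),
          ENNReal.inv_mul_cancel hℓ0 ENNReal.ofReal_ne_top, one_mul]

theorem LipschitzWith.enorm_rpow_le_lintegral {K : ℝ≥0} {φ : ℝ → ℝ} (hφ : LipschitzWith K φ)
    {a b x s : ℝ} (hab : a < b) (hx : x ∈ Icc a b) (hs : 1 ≤ s) :
    ‖φ x‖ₑ ^ s ≤ ∫⁻ t in Icc a b, ‖φ t‖ₑ ^ (s - 1) *
      ((ENNReal.ofReal (b - a))⁻¹ * ‖φ t‖ₑ + ENNReal.ofReal s * ‖deriv φ t‖ₑ) := by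
  rcases hs.eq_or_lt with rfl | hs1
  · simpa using hφ.locallyLipschitz.enorm_le_lintegral hab hx
  have hs0 : 0 ≤ s := by linarith
  have he : ∀ y : ℝ, ‖|y| ^ s‖ₑ = ‖y‖ₑ ^ s := fun y => by
    rw [Real.enorm_rpow_of_nonneg (abs_nonneg _) hs0, Real.enorm_abs]
  have hL : LocallyLipschitz fun t => |φ t| ^ s := by
    have := (contDiff_norm_rpow (E := ℝ) hs1).locallyLipschitz.comp hφ.locallyLipschitz
    simpa [Function.comp_def] using this
  have h1 := hL.enorm_le_lintegral hab hx
  simp only [he] at h1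
  refine h1.trans (lintegral_mono_ae ?_)
  filter_upwards [ae_restrict_of_ae hφ.ae_differentiableAt_real] with t ht
  have hd := (hasDerivAt_abs_rpow (φ t) hs1).comp t ht.hasDerivAt
  have hd' : deriv (fun t => |φ t| ^ s) t = s * |φ t| ^ (s - 2) * φ t * deriv φ t := hd.deriv
  have hp : ‖φ t‖ₑ ^ s = ‖φ t‖ₑ ^ (s - 1) * ‖φ t‖ₑ := by
    conv_rhs => rw [← ENNReal.rpow_one ‖φ t‖ₑ, ← ENNReal.rpow_mul, one_mul]
    rw [← ENNReal.rpow_add_of_nonneg _ _ (by linarith) (by norm_num)]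
    ring_nf
  have hq : ‖|φ t| ^ (s - 2) * φ t‖ₑ = ‖φ t‖ₑ ^ (s - 1) := by
    rcases eq_or_ne (φ t) 0 with h0 | h0
    · simp [h0, ENNReal.zero_rpow_of_pos (sub_pos.2 hs1)]
    · have h3 : |φ t| ^ (s - 2) * |φ t| = |φ t| ^ (s - 1) := by
        rw [← Real.rpow_add_one (abs_ne_zero.2 h0)]; ring_nf
      rw [enorm_mul, ← Real.enorm_abs (φ t), ← enorm_mul, h3,
        Real.enorm_rpow_of_nonneg (abs_nonneg _) (by linarith)]
  have hs' : ‖s‖ₑ = ENNReal.ofReal s := Real.enorm_of_nonneg hs0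
  rw [hd', mul_assoc s, enorm_mul, enorm_mul, hq, hp, hs']
  apply le_of_eq
  ring

end OneDimensional

section Poincare

theorem lintegral_rpow_le_measure_univ_mul {α : Type*} [MeasurableSpace α] {μ : Measure α}
    {g : α → ℝ≥0∞} (hg : AEMeasurable g μ) {p : ℝ} (hp : 1 ≤ p) :
    (∫⁻ a, g a ∂μ) ^ p ≤ μ univ ^ (p - 1) * ∫⁻ a, g a ^ p ∂μ := by
  have hp0 : 0 < p := by linarith
  have h := eLpNorm'_le_eLpNorm'_mul_rpow_measure_univ (μ := μ) one_pos hp hg.aestronglyMeasurable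
  simp only [eLpNorm', enorm_eq_self, ENNReal.rpow_one, div_one] at h
  calc (∫⁻ a, g a ∂μ) ^ p
      ≤ ((∫⁻ a, g a ^ p ∂μ) ^ (1 / p) * μ univ ^ (1 - 1 / p)) ^ p :=
        ENNReal.rpow_le_rpow h hp0.le
    _ = _ := by
        rw [ENNReal.mul_rpow_of_nonneg _ _ hp0.le, ← ENNReal.rpow_mul, ← ENNReal.rpow_mul,
          mul_comm]
        congr 2 <;> field_simp
        simp

variable {E : Type*} [NormedAddCommGroup E] [NormedSpace ℝ E] [MeasurableSpace E] [BorelSpace E]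
  [FiniteDimensional ℝ E] (μ : Measure E) [μ.IsAddHaarMeasure]

theorem lintegral_comp_add_smul_le {g : E → ℝ≥0∞} (hg : Measurable g) (z : E) {t : ℝ}
    (ht : 1 / 2 ≤ t) :
    ∫⁻ y, g (z + t • y) ∂μ ≤ 2 ^ Module.finrank ℝ E * ∫⁻ y, g y ∂μ := by
  have ht0 : 0 < t := by linarith
  have h1 : ∫⁻ y, g (z + t • y) ∂μ = ∫⁻ y, g (z + y) ∂(Measure.map (fun y => t • y) μ) := by
    rw [lintegral_map (f := fun y => g (z + y)) (hg.comp (measurable_const_add z))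
      (measurable_const_smul t)]
  rw [h1, Measure.map_addHaar_smul μ ht0.ne', lintegral_smul_measure,
    lintegral_add_left_eq_self g z, smul_eq_mul]
  gcongr
  have h2 : |(t ^ Module.finrank ℝ E)⁻¹| ≤ 2 ^ Module.finrank ℝ E := by
    rw [abs_of_pos (by positivity), ← inv_pow]
    gcongr
    rw [inv_le_comm₀ ht0 (by norm_num)]
    linarith
  refine (ENNReal.ofReal_le_ofReal h2).trans (le_of_eq ?_)
  rw [ENNReal.ofReal_pow (by norm_num)]
  simp

theorem Convex.lintegral_lintegral_segment_le {s : Set E} (hs : Convex ℝ s)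
    (hsm : MeasurableSet s) {g : E → ℝ≥0∞} (hg : Measurable g) {t : ℝ} (ht : t ∈ Icc (0:ℝ) 1) :
    ∫⁻ x in s, ∫⁻ y in s, g (x + t • (y - x)) ∂μ ∂μ ≤
      2 ^ Module.finrank ℝ E * μ s * ∫⁻ y in s, g y ∂μ := by
  have half : ∀ t ∈ Icc (1 / 2 : ℝ) 1, ∫⁻ x in s, ∫⁻ y in s, g (x + t • (y - x)) ∂μ ∂μ ≤
      2 ^ Module.finrank ℝ E * μ s * ∫⁻ y in s, g y ∂μ := by
    intro t ht
    have h1 : ∀ x ∈ s, ∫⁻ y in s, g (x + t • (y - x)) ∂μ ≤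
        2 ^ Module.finrank ℝ E * ∫⁻ y in s, g y ∂μ := by
      intro x hx
      calc ∫⁻ y in s, g (x + t • (y - x)) ∂μ
          ≤ ∫⁻ y in s, s.indicator g ((x - t • x) + t • y) ∂μ := by
            refine setLIntegral_mono' hsm fun y hy => ?_
            have h2 : x + t • (y - x) = (x - t • x) + t • y := by rw [smul_sub]; abel
            have h3 : x + t • (y - x) ∈ s :=
              hs.add_smul_sub_mem hx hy ⟨by linarith [ht.1], ht.2⟩
            rw [← h2, indicator_of_mem h3]
        _ ≤ ∫⁻ y, s.indicator g ((x - t • x) + t • y) ∂μ := setLIntegral_le_lintegral _ _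
        _ ≤ _ := lintegral_comp_add_smul_le μ (hg.indicator hsm) _ ht.1
        _ = _ := by rw [lintegral_indicator hsm]
    refine (setLIntegral_mono' hsm h1).trans (le_of_eq ?_)
    rw [setLIntegral_const]
    ring
  rcases le_total (1 / 2) t with h | h
  · exact half t ⟨h, ht.2⟩
  · rw [lintegral_lintegral_swap]
    · refine le_trans (le_of_eq ?_) (half (1 - t) ⟨by linarith, by linarith [ht.1]⟩)
      congr! 4 with y x
      rw [sub_smul, one_smul, smul_sub, smul_sub]
      abel_nf
    · apply Measurable.aemeasurable
      fun_prop

theorem Convex.lintegral_lintegral_enorm_sub_rpow_le {s : Set E} (hs : Convex ℝ s)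
    (hsm : MeasurableSet s) {K : ℝ≥0} {f : E → ℝ} (hf : LipschitzWith K f) {d : ℝ≥0∞}
    (hd : ∀ x ∈ s, ∀ y ∈ s, ‖y - x‖ₑ ≤ d) {p : ℝ} (hp : 1 ≤ p) :
    ∫⁻ x in s, ∫⁻ y in s, ‖f x - f y‖ₑ ^ p ∂μ ∂μ ≤
      d ^ p * (2 ^ Module.finrank ℝ E * μ s * ∫⁻ y in s, upperGrad K f y ^ p ∂μ) := by
  have hp0 : 0 ≤ p := by linarith
  have hD : Measurable (upperGrad K f) := measurable_upperGrad K f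
  have hpt : ∀ x ∈ s, ∀ y ∈ s, ‖f x - f y‖ₑ ^ p ≤
      d ^ p * ∫⁻ t in Icc (0:ℝ) 1, upperGrad K f (x + t • (y - x)) ^ p := by
    intro x hx y hy
    have h1 := (lipschitzWith_comp_line hf x (y - x)).locallyLipschitz.enorm_sub_le_lintegral_deriv
      (left_mem_Icc.2 zero_le_one) (right_mem_Icc.2 (zero_le_one (α := ℝ)))
    simp only [zero_smul, one_smul, add_zero, add_sub_cancel] at h1
    have h2 : ‖f x - f y‖ₑ ≤ d * ∫⁻ t in Icc (0:ℝ) 1, upperGrad K f (x + t • (y - x)) := by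
      rw [← lintegral_const_mul _ (by fun_prop)]
      refine h1.trans (lintegral_mono fun t => ?_)
      refine (enorm_deriv_line_le hf x (y - x) t).trans ?_
      rw [mul_comm]
      gcongr
      exact hd x hx y hy
    refine (ENNReal.rpow_le_rpow h2 hp0).trans ?_
    rw [ENNReal.mul_rpow_of_nonneg _ _ hp0]
    gcongr
    refine (lintegral_rpow_le_measure_univ_mul (Measurable.aemeasurable (by fun_prop)) hp).trans ?_
    simp
  calc ∫⁻ x in s, ∫⁻ y in s, ‖f x - f y‖ₑ ^ p ∂μ ∂μ
      ≤ ∫⁻ x in s, ∫⁻ y in s, d ^ p *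
          (∫⁻ t in Icc (0:ℝ) 1, upperGrad K f (x + t • (y - x)) ^ p) ∂μ ∂μ :=
        setLIntegral_mono' hsm fun x hx => setLIntegral_mono' hsm fun y hy => hpt x hx y hy
    _ = d ^ p * ∫⁻ t in Icc (0:ℝ) 1, ∫⁻ x in s, ∫⁻ y in s,
          upperGrad K f (x + t • (y - x)) ^ p ∂μ ∂μ := by
        have e1 : ∀ x, ∫⁻ y in s, d ^ p *
            (∫⁻ t in Icc (0:ℝ) 1, upperGrad K f (x + t • (y - x)) ^ p) ∂μ =
            d ^ p * ∫⁻ t in Icc (0:ℝ) 1, ∫⁻ y in s, upperGrad K f (x + t • (y - x)) ^ p ∂μ := by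
          intro x
          have hmx : Measurable fun y =>
              ∫⁻ t in Icc (0:ℝ) 1, upperGrad K f (x + t • (y - x)) ^ p :=
            Measurable.lintegral_prod_right'
              (f := fun q : E × ℝ => upperGrad K f (x + q.2 • (q.1 - x)) ^ p) (by fun_prop)
          rw [lintegral_const_mul _ hmx, lintegral_lintegral_swap]
          apply Measurable.aemeasurable
          fun_prop
        simp_rw [e1]
        have hm2 : Measurable fun q : E × ℝ =>
            ∫⁻ y in s, upperGrad K f (q.1 + q.2 • (y - q.1)) ^ p ∂μ := by
          have : Measurable fun r : (E × ℝ) × E =>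
            upperGrad K f (r.1.1 + r.1.2 • (r.2 - r.1.1)) ^ p := by fun_prop
          exact this.lintegral_prod_right'
        rw [lintegral_const_mul _ hm2.lintegral_prod_right', lintegral_lintegral_swap]
        exact hm2.aemeasurable
    _ ≤ d ^ p * ∫⁻ t in Icc (0:ℝ) 1,
          2 ^ Module.finrank ℝ E * μ s * ∫⁻ y in s, upperGrad K f y ^ p ∂μ := by
        exact mul_le_mul_right (setLIntegral_mono' measurableSet_Icc fun t ht =>
          hs.lintegral_lintegral_segment_le μ hsm (hD.pow_const p) ht) _
    _ = _ := by simp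

theorem Convex.poincare_upperGrad {s : Set E} (hs : Convex ℝ s)
    (hsm : MeasurableSet s) (hs0 : μ s ≠ 0) (hst : μ s ≠ ∞) {K : ℝ≥0} {f : E → ℝ}
    (hf : LipschitzWith K f) (hfi : IntegrableOn f s μ) {d : ℝ≥0∞}
    (hd : ∀ x ∈ s, ∀ y ∈ s, ‖y - x‖ₑ ≤ d) {p : ℝ} (hp : 1 ≤ p) :
    (∫⁻ x in s, ‖f x - (μ s).toReal⁻¹ * ∫ y in s, f y ∂μ‖ₑ ^ p ∂μ) ^ (1 / p) ≤
      2 ^ Module.finrank ℝ E * d * (∫⁻ y in s, upperGrad K f y ^ p ∂μ) ^ (1 / p) := by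
  have hp0 : 0 < p := by linarith
  have hfin : IsFiniteMeasure (μ.restrict s) := ⟨by simpa using hst.lt_top⟩
  have hfm : Measurable f := hf.continuous.measurable
  have hpt : ∀ x, ‖f x - (μ s).toReal⁻¹ * ∫ y in s, f y ∂μ‖ₑ ^ p ≤
      (μ s)⁻¹ * ∫⁻ y in s, ‖f x - f y‖ₑ ^ p ∂μ := by
    intro x
    have hr : (μ s).toReal ≠ 0 := (ENNReal.toReal_pos hs0 hst).ne'
    have h1 : f x - (μ s).toReal⁻¹ * ∫ y in s, f y ∂μ =
        (μ s).toReal⁻¹ * ∫ y in s, (f x - f y) ∂μ := by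
      rw [integral_sub (integrable_const _) hfi]
      simp [Measure.real]
      field_simp
    have h2 : ‖(μ s).toReal⁻¹‖ₑ = (μ s)⁻¹ := by
      rw [enorm_inv hr, Real.enorm_of_nonneg ENNReal.toReal_nonneg, ENNReal.ofReal_toReal hst]
    rw [h1, enorm_mul, h2, ENNReal.mul_rpow_of_nonneg _ _ hp0.le]
    have h3 : ‖∫ y in s, (f x - f y) ∂μ‖ₑ ^ p ≤
        μ s ^ (p - 1) * ∫⁻ y in s, ‖f x - f y‖ₑ ^ p ∂μ := by
      refine (ENNReal.rpow_le_rpow (enorm_integral_le_lintegral_enorm _) hp0.le).trans ?_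
      refine (lintegral_rpow_le_measure_univ_mul (Measurable.aemeasurable (by fun_prop)) hp).trans ?_
      simp
    refine (mul_le_mul_right h3 _).trans (le_of_eq ?_)
    rw [← mul_assoc]
    congr 1
    rw [ENNReal.inv_rpow, ← ENNReal.rpow_neg, ← ENNReal.rpow_add _ _ hs0 hst,
      ← ENNReal.rpow_neg_one]
    ring_nf
  have hm : Measurable fun x => ∫⁻ y in s, ‖f x - f y‖ₑ ^ p ∂μ := by
    have : Measurable fun q : E × E => ‖f q.1 - f q.2‖ₑ ^ p := by fun_prop
    exact this.lintegral_prod_right'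
  have key : ∫⁻ x in s, ‖f x - (μ s).toReal⁻¹ * ∫ y in s, f y ∂μ‖ₑ ^ p ∂μ ≤
      d ^ p * (2 ^ Module.finrank ℝ E * ∫⁻ y in s, upperGrad K f y ^ p ∂μ) := by
    refine (lintegral_mono hpt).trans ?_
    rw [lintegral_const_mul _ hm]
    refine (mul_le_mul_right (hs.lintegral_lintegral_enorm_sub_rpow_le μ hsm hf hd hp) _).trans
      (le_of_eq ?_)
    calc _ = d ^ p * (2 ^ Module.finrank ℝ E * ((μ s)⁻¹ * μ s) *
            ∫⁻ y in s, upperGrad K f y ^ p ∂μ) := by ring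
      _ = _ := by rw [ENNReal.inv_mul_cancel hs0 hst, mul_one]
  refine (ENNReal.rpow_le_rpow key (by positivity)).trans ?_
  rw [ENNReal.mul_rpow_of_nonneg _ _ (by positivity), ENNReal.mul_rpow_of_nonneg _ _ (by positivity),
    ← ENNReal.rpow_mul, mul_one_div_cancel hp0.ne', ENNReal.rpow_one, ← mul_assoc,
    mul_comm d]
  gcongr
  have h1 : (1 : ℝ≥0∞) ≤ 2 ^ Module.finrank ℝ E := one_le_pow₀ (by norm_num)
  calc ((2 : ℝ≥0∞) ^ Module.finrank ℝ E) ^ (1 / p)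
      ≤ ((2 : ℝ≥0∞) ^ Module.finrank ℝ E) ^ (1 : ℝ) :=
        ENNReal.rpow_le_rpow_of_exponent_le h1 (by rw [div_le_one hp0]; exact hp)
    _ = _ := ENNReal.rpow_one _

end Poincare

section Cube

variable {n : ℕ}

theorem preimage_toLp_closedCube (c : Eucl n) (r : ℝ) :
    WithLp.toLp 2 ⁻¹' closedCube c r = univ.pi fun i => Icc (c i - r) (c i + r) := by
  ext x
  simp only [closedCube, mem_preimage, mem_ofPred_eq, mem_univ_pi, abs_le, mem_Icc]
  refine forall_congr' fun i => and_congr ?_ ?_ <;> constructor <;> intro h <;> linarith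

theorem isClosed_closedCube (c : Eucl n) (r : ℝ) : IsClosed (closedCube c r) := by
  simp only [closedCube, ofPred_forall]
  exact isClosed_iInter fun i => isClosed_le (by fun_prop) continuous_const

theorem convex_closedCube (c : Eucl n) (r : ℝ) : Convex ℝ (closedCube c r) := by
  intro x hx y hy a b ha hb hab i
  have h1 : (a • x + b • y) i - c i = a * (x i - c i) + b * (y i - c i) := by
    simp only [PiLp.add_apply, PiLp.smul_apply, smul_eq_mul]
    linear_combination c i * hab
  rw [h1]
  calc |a * (x i - c i) + b * (y i - c i)| ≤ a * |x i - c i| + b * |y i - c i| := by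
        refine (abs_add_le _ _).trans ?_
        rw [abs_mul, abs_mul, abs_of_nonneg ha, abs_of_nonneg hb]
    _ ≤ a * r + b * r := by gcongr <;> [exact hx i; exact hy i]
    _ = r := by rw [← add_mul, hab, one_mul]

theorem norm_sub_le_of_mem_closedCube {c : Eucl n} {r : ℝ} (hr : 0 ≤ r) {x y : Eucl n}
    (hx : x ∈ closedCube c r) (hy : y ∈ closedCube c r) : ‖y - x‖ ≤ n * (2 * r) := by
  rw [EuclideanSpace.norm_eq]
  refine Real.sqrt_le_iff.2 ⟨by positivity, ?_⟩
  have h1 : ∀ i, ‖(y - x) i‖ ^ 2 ≤ (2 * r) ^ 2 := fun i => by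
    have h2 : ‖(y - x) i‖ ≤ 2 * r := by
      have h3 := abs_le.1 (hx i)
      have h4 := abs_le.1 (hy i)
      rw [PiLp.sub_apply, Real.norm_eq_abs, abs_le]
      constructor <;> linarith
    exact pow_le_pow_left₀ (norm_nonneg _) h2 2
  refine (Finset.sum_le_sum fun i _ => h1 i).trans ?_
  rw [Finset.sum_const, Finset.card_univ, Fintype.card_fin, nsmul_eq_mul, mul_pow (n : ℝ)]
  refine mul_le_mul_of_nonneg_right ?_ (sq_nonneg _)
  exact_mod_cast Nat.le_self_pow (by norm_num) n

theorem isCompact_closedCube (c : Eucl n) {r : ℝ} (hr : 0 ≤ r) : IsCompact (closedCube c r) := by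
  refine Metric.isCompact_of_isClosed_isBounded (isClosed_closedCube c r) ?_
  refine Metric.isBounded_iff.2 ⟨n * (2 * r), fun x hx y hy => ?_⟩
  rw [dist_eq_norm]
  exact norm_sub_le_of_mem_closedCube hr hy hx

theorem volume_closedCube_ne_zero (c : Eucl n) {r : ℝ} (hr : 0 < r) :
    volume (closedCube c r) ≠ 0 := by
  rw [← (PiLp.volume_preserving_toLp (Fin n)).measure_preimage
    (isClosed_closedCube c r).measurableSet.nullMeasurableSet, preimage_toLp_closedCube,
    volume_pi_pi, Finset.prod_ne_zero_iff]
  intro i _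
  rw [Real.volume_Icc]
  simp only [ne_eq, ENNReal.ofReal_eq_zero, not_le]
  linarith

/-- Gagliardo–Nirenberg inequality on a cube for `|f| ^ s`. -/
theorem lintegral_closedCube_rpow_le (hn : 2 ≤ n) {K : ℝ≥0} {f : Eucl n → ℝ}
    (hf : LipschitzWith K f) (c : Eucl n) {r : ℝ} (hr : 0 < r) {s : ℝ} (hs : 1 ≤ s) :
    ∫⁻ x in closedCube c r, (‖f x‖ₑ ^ s) ^ ((n : ℝ) / (n - 1)) ≤
      (∫⁻ x in closedCube c r, ‖f x‖ₑ ^ (s - 1) * ((ENNReal.ofReal (2 * r))⁻¹ * ‖f x‖ₑ +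
        ENNReal.ofReal s * upperGrad K f x)) ^ ((n : ℝ) / (n - 1)) := by
  have hn1 : (1 : ℝ) < n := by exact_mod_cast hn
  set g : Eucl n → ℝ≥0∞ := fun x => ‖f x‖ₑ ^ (s - 1) * ((ENNReal.ofReal (2 * r))⁻¹ * ‖f x‖ₑ +
        ENNReal.ofReal s * upperGrad K f x) with hgdef
  have hD := measurable_upperGrad K f
  have hfm : Measurable f := hf.continuous.measurable
  have hg : Measurable g := by fun_prop
  have hQ := (isClosed_closedCube c r).measurableSet
  have hmp := PiLp.volume_preserving_toLp (Fin n)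
  have hcv : ∀ F : Eucl n → ℝ≥0∞, Measurable F → ∫⁻ x in closedCube c r, F x =
      ∫⁻ x, F (WithLp.toLp 2 x)
        ∂(Measure.pi fun i => volume.restrict (Icc (c i - r) (c i + r))) := by
    intro F hF
    rw [← hmp.setLIntegral_comp_preimage hQ hF, preimage_toLp_closedCube, volume_pi,
      Measure.restrict_pi_pi]
  have hline : ∀ x ∈ univ.pi fun i => Icc (c i - r) (c i + r), ∀ i,
      ‖f (WithLp.toLp 2 x)‖ₑ ^ s ≤
        ∫⁻ t in Icc (c i - r) (c i + r), g (WithLp.toLp 2 (Function.update x i t)) := by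
    intro x hx i
    set z : Eucl n := WithLp.toLp 2 (Function.update x i 0) with hz
    set e : Eucl n := EuclideanSpace.single i (1 : ℝ) with he
    have hupd : ∀ t : ℝ, WithLp.toLp 2 (Function.update x i t) = z + t • e := by
      intro t
      ext j
      by_cases hj : j = i
      · subst hj; simp [hz, he]
      · simp [hz, he, hj]
    have hx' : WithLp.toLp 2 x = z + x i • e := by rw [← hupd, Function.update_eq_self]
    have h1 := (lipschitzWith_comp_line hf z e).enorm_rpow_le_lintegral
      (a := c i - r) (b := c i + r) (by linarith) (hx i (mem_univ i)) hs
    rw [hx']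
    refine h1.trans (lintegral_mono fun t => ?_)
    have h2 := enorm_deriv_line_le hf z e t
    have h3 : ‖e‖ₑ = 1 := by simp [he, enorm_eq_nnnorm]
    rw [h3, mul_one] at h2
    have h4 : c i + r - (c i - r) = 2 * r := by ring
    simp only [hgdef, hupd, h4]
    gcongr
  have hconj : Real.HolderConjugate (Fintype.card (Fin n)) ((n : ℝ) / (n - 1)) := by
    rw [Fintype.card_fin]
    exact Real.HolderConjugate.conjExponent hn1
  have hgl := lintegral_prod_lintegral_pow_le
    (fun i : Fin n => (volume : Measure ℝ).restrict (Icc (c i - r) (c i + r))) hconj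
    (f := fun x => g (WithLp.toLp 2 x)) (hg.comp hmp.measurable)
  rw [hcv _ (by fun_prop), hcv g hg]
  refine le_trans (lintegral_mono_ae ?_) hgl
  have hae : ∀ᵐ x ∂(Measure.pi fun i => (volume : Measure ℝ).restrict (Icc (c i - r) (c i + r))),
      x ∈ univ.pi fun i => Icc (c i - r) (c i + r) := by
    rw [← Measure.restrict_pi_pi]
    exact ae_restrict_mem (MeasurableSet.univ_pi fun i => measurableSet_Icc)
  filter_upwards [hae] with x hx
  have hpow : (‖f (WithLp.toLp 2 x)‖ₑ ^ s) ^ ((n : ℝ) / (n - 1)) =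
      ∏ _i : Fin n, (‖f (WithLp.toLp 2 x)‖ₑ ^ s) ^ ((1 : ℝ) / (n - 1)) := by
    rw [Finset.prod_const, Finset.card_univ, Fintype.card_fin, ← ENNReal.rpow_natCast,
      ← ENNReal.rpow_mul _ _ (n : ℝ)]
    congr 1
    ring
  rw [hpow, Fintype.card_fin]
  refine Finset.prod_le_prod' fun i _ => ENNReal.rpow_le_rpow (hline x hx i) ?_
  have : (0 : ℝ) < n - 1 := by linarith
  positivity

theorem lintegral_closedCube_enorm_rpow_ne_top {f : Eucl n → ℝ} (hf : Continuous f) (c : Eucl n)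
    {r : ℝ} (hr : 0 ≤ r) {q : ℝ} (hq : 0 ≤ q) :
    ∫⁻ x in closedCube c r, ‖f x‖ₑ ^ q ≠ ∞ := by
  have hK := isCompact_closedCube c hr
  have h1 := setLIntegral_lt_top_of_isCompact (μ := volume) hK.measure_lt_top.ne hK
    (f := fun x => ‖f x‖₊ ^ q) ((NNReal.continuous_rpow_const hq).comp hf.nnnorm)
  simpa [ENNReal.coe_rpow_of_nonneg _ hq, enorm_eq_nnnorm] using h1.ne

/-- Sobolev inequality on a cube, with lower-order term, for `1 / p = 1 / q + 1 / n`. -/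
theorem sobolev_closedCube (hn : 2 ≤ n) {K : ℝ≥0} {f : Eucl n → ℝ}
    (hf : LipschitzWith K f) (c : Eucl n) {r : ℝ} (hr : 0 < r) {p q : ℝ} (hp : 1 ≤ p)
    (hq : 0 < q) (hpq : 1 / p = 1 / q + 1 / n) :
    (∫⁻ x in closedCube c r, ‖f x‖ₑ ^ q) ^ (1 / q) ≤
      (ENNReal.ofReal (2 * r))⁻¹ * (∫⁻ x in closedCube c r, ‖f x‖ₑ ^ p) ^ (1 / p) +
      ENNReal.ofReal q * (∫⁻ x in closedCube c r, upperGrad K f x ^ p) ^ (1 / p) := by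
  have hn1 : (1 : ℝ) < n := by exact_mod_cast hn
  have hn0 : (0 : ℝ) < n := by linarith
  have hn10 : (0 : ℝ) < n - 1 := by linarith
  have hp0 : 0 < p := by linarith
  have hD := measurable_upperGrad K f
  have hfm : Measurable f := hf.continuous.measurable
  have hsub : q * (n - 1) / n - 1 = q * (1 - 1 / p) := by
    rw [hpq]; field_simp; ring
  set s : ℝ := q * (n - 1) / n with hsdef
  have hp1 : 1 / p ≤ 1 := by rw [div_le_one hp0]; exact hp
  have hs1 : 1 ≤ s := by nlinarith
  have hsq : s ≤ q := by
    rw [hsdef, div_le_iff₀ hn0]; nlinarith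
  set A := ∫⁻ x in closedCube c r, ‖f x‖ₑ ^ q with hA
  have hAtop : A ≠ ∞ := lintegral_closedCube_enorm_rpow_ne_top hf.continuous c hr.le hq.le
  rcases eq_or_ne A 0 with hA0 | hA0
  · rw [hA0, ENNReal.zero_rpow_of_pos (by positivity)]
    exact zero_le
  set h : Eucl n → ℝ≥0∞ := fun x => (ENNReal.ofReal (2 * r))⁻¹ * ‖f x‖ₑ +
        ENNReal.ofReal s * upperGrad K f x with hh
  have hhm : Measurable h := by fun_prop
  have hGN := lintegral_closedCube_rpow_le hn hf c hr hs1
  have e1 : ∫⁻ x in closedCube c r, (‖f x‖ₑ ^ s) ^ ((n : ℝ) / (n - 1)) = A := by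
    simp_rw [hA, ← ENNReal.rpow_mul]
    congr! 3
    rw [hsdef]; field_simp
  rw [e1] at hGN
  have hGN' : A ^ (((n : ℝ) - 1) / n) ≤ ∫⁻ x in closedCube c r, ‖f x‖ₑ ^ (s - 1) * h x := by
    refine (ENNReal.rpow_le_rpow hGN (by positivity)).trans (le_of_eq ?_)
    rw [← ENNReal.rpow_mul, show (n : ℝ) / (n - 1) * ((n - 1) / n) = 1 by field_simp,
      ENNReal.rpow_one]
  have hHolder : ∫⁻ x in closedCube c r, ‖f x‖ₑ ^ (s - 1) * h x ≤
      A ^ (1 - 1 / p) * (∫⁻ x in closedCube c r, h x ^ p) ^ (1 / p) := by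
    rcases hp.eq_or_lt with rfl | hp'
    · have : s - 1 = 0 := by rw [hsub]; norm_num
      simp [this]
    · have hconj : (p / (p - 1)).HolderConjugate p := (Real.HolderConjugate.conjExponent hp').symm
      refine (ENNReal.lintegral_mul_le_Lp_mul_Lq (volume.restrict (closedCube c r)) hconj
        (f := fun x => ‖f x‖ₑ ^ (s - 1)) (g := h) (by fun_prop) hhm.aemeasurable).trans ?_
      have hp10 : p - 1 ≠ 0 := by linarith
      have e2 : 1 / (p / (p - 1)) = 1 - 1 / p := by field_simp
      have e3 : (s - 1) * (p / (p - 1)) = q := by rw [hsub]; field_simp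
      simp_rw [← ENNReal.rpow_mul, e2, e3]
      exact le_rfl
  have hexp : ((n : ℝ) - 1) / n = (1 - 1 / p) + 1 / q := by
    rw [hpq]; field_simp; ring
  have hcancel : A ^ (1 / q) ≤ (∫⁻ x in closedCube c r, h x ^ p) ^ (1 / p) := by
    have h1 := hGN'.trans hHolder
    rw [hexp, ENNReal.rpow_add _ _ hA0 hAtop] at h1
    refine (ENNReal.mul_le_mul_iff_right ?_ ?_).1 h1
    · simp [ENNReal.rpow_eq_zero_iff, hA0, hAtop]
    · exact ENNReal.rpow_ne_top_of_nonneg (by linarith) hAtop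
  refine hcancel.trans ?_
  refine (ENNReal.lintegral_Lp_add_le (f := fun x => (ENNReal.ofReal (2 * r))⁻¹ * ‖f x‖ₑ)
    (g := fun x => ENNReal.ofReal s * upperGrad K f x) (by fun_prop) (by fun_prop) hp).trans ?_
  have hconst : ∀ (a : ℝ≥0∞) (w : Eucl n → ℝ≥0∞), Measurable w →
      (∫⁻ x in closedCube c r, (a * w x) ^ p) ^ (1 / p) =
        a * (∫⁻ x in closedCube c r, w x ^ p) ^ (1 / p) := by
    intro a w hw
    simp_rw [ENNReal.mul_rpow_of_nonneg _ _ hp0.le]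
    rw [lintegral_const_mul _ (hw.pow_const p), ENNReal.mul_rpow_of_nonneg _ _ (by positivity),
      ← ENNReal.rpow_mul, mul_one_div_cancel hp0.ne', ENNReal.rpow_one]
  rw [hconst _ _ hfm.enorm, hconst _ _ hD]
  gcongr

theorem upperGrad_sub_const {E : Type*} [NormedAddCommGroup E] [NormedSpace ℝ E] (K : ℝ≥0)
    (f : E → ℝ) (a : ℝ) : upperGrad K (fun x => f x - a) = upperGrad K f := by
  ext x
  have h : DifferentiableAt ℝ (fun x => f x - a) x ↔ DifferentiableAt ℝ f x := by
    simp only [sub_eq_add_neg, differentiableAt_add_const_iff]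
  by_cases hx : DifferentiableAt ℝ f x
  · simp [upperGrad, fderiv_sub_const, hx]
  · simp [upperGrad, h, hx]

/-- Sobolev–Poincaré inequality on a cube for `1 / p = 1 / q + 1 / n`. -/
theorem sobolev_poincare_closedCube (hn : 2 ≤ n) {K : ℝ≥0} {f : Eucl n → ℝ}
    (hf : LipschitzWith K f) (c : Eucl n) {r : ℝ} (hr : 0 < r) {p q : ℝ} (hp : 1 ≤ p)
    (hq : 0 < q) (hpq : 1 / p = 1 / q + 1 / n) :
    (∫⁻ x in closedCube c r, ‖f x - avgOn (closedCube c r) f‖ₑ ^ q) ^ (1 / q) ≤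
      ENNReal.ofReal (n * 2 ^ n + q) *
        (∫⁻ x in closedCube c r, upperGrad K f x ^ p) ^ (1 / p) := by
  have hK := isCompact_closedCube c hr.le
  have hfv : LipschitzWith K fun x => f x - avgOn (closedCube c r) f := by
    simpa using hf.sub (LipschitzWith.const (avgOn (closedCube c r) f))
  have h1 := sobolev_closedCube hn hfv c hr hp hq hpq
  rw [upperGrad_sub_const] at h1
  have h2 := (convex_closedCube c r).poincare_upperGrad volume
    (isClosed_closedCube c r).measurableSet (volume_closedCube_ne_zero c hr)
    hK.measure_lt_top.ne hf (hf.continuous.continuousOn.integrableOn_compact hK)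
    (d := ENNReal.ofReal (n * (2 * r))) (fun x hx y hy => by
      rw [← ofReal_norm]
      exact ENNReal.ofReal_le_ofReal (norm_sub_le_of_mem_closedCube hr.le hx hy)) hp
  refine h1.trans ((add_le_add_left (mul_le_mul_right h2 _) _).trans (le_of_eq ?_))
  have hr0 : ENNReal.ofReal (2 * r) ≠ 0 := by simpa using hr
  rw [← mul_assoc, ← add_mul]
  congr 1
  rw [ENNReal.ofReal_add (by positivity) hq.le, finrank_euclideanSpace, Fintype.card_fin,
    ENNReal.ofReal_mul (Nat.cast_nonneg n) (q := 2 * r),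
    ENNReal.ofReal_mul (Nat.cast_nonneg n) (q := 2 ^ n), ENNReal.ofReal_pow (by norm_num)]
  congr 1
  calc _ = (ENNReal.ofReal (2 * r))⁻¹ * ENNReal.ofReal (2 * r) *
        (ENNReal.ofReal n * 2 ^ n) := by ring
    _ = _ := by
      rw [ENNReal.inv_mul_cancel hr0 ENNReal.ofReal_ne_top, one_mul]
      simp

end Cube

section Reduction

variable {n : ℕ}

/-- Sobolev–Poincaré inequality on a cube for a globally Lipschitz function. -/
theorem sobolev_poincare_closedCube_of_le (hn : 2 ≤ n) {K : ℝ≥0} {f : Eucl n → ℝ}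
    (hf : LipschitzWith K f) (c : Eucl n) {r : ℝ} (hr : 0 < r) {p q : ℝ} (hp : 1 ≤ p)
    (hpn : p < n) (hpq : p ≤ q) (hq : q ≤ n * p / (n - p)) :
    (∫⁻ x in closedCube c r, ‖f x - avgOn (closedCube c r) f‖ₑ ^ q) ^ (1 / q) ≤
      ENNReal.ofReal ((n * 2 ^ n + 2) * q) *
        volume (closedCube c r) ^ (1 / (n : ℝ) + 1 / q - 1 / p) *
        (∫⁻ x in closedCube c r, ‖fderiv ℝ f x‖ₑ ^ p) ^ (1 / p) := by
  have hn2 : (2 : ℝ) ≤ n := by exact_mod_cast hn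
  have hn0 : (0 : ℝ) < n := by linarith
  have hn10 : (0 : ℝ) < n - 1 := by linarith
  have hp0 : 0 < p := by linarith
  have hq0 : 0 < q := by linarith
  -- reduce to critical exponents, decreasing p and increasing q
  set q' : ℝ := max q (n / (n - 1)) with hq'
  set p' : ℝ := n * q' / (n + q') with hp'
  have hqq' : q ≤ q' := le_max_left _ _
  have hnq' : n / (n - 1) ≤ q' := le_max_right _ _
  have hq'0 : 0 < q' := by linarith
  have hrel : 1 / p' = 1 / q' + 1 / n := by
    rw [hp']; field_simp
  have hp'1 : 1 ≤ p' := by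
    rw [hp', le_div_iff₀ (by positivity)]
    rw [div_le_iff₀ hn10] at hnq'
    linarith
  have hp'0 : 0 < p' := by linarith
  have hnp : 0 < n - p := by linarith
  have hq'p : q' ≤ n * p / (n - p) := by
    refine max_le hq ?_
    rw [div_le_div_iff₀ hn10 hnp]
    nlinarith [mul_nonneg (mul_nonneg hn0.le hn0.le) (sub_nonneg.2 hp)]
  have hp'p : p' ≤ p := by
    rw [le_div_iff₀ hnp] at hq'p
    rw [hp', div_le_iff₀ (by positivity)]
    linarith
  have hq'2 : q' ≤ 2 * q := by
    refine max_le (by linarith) ?_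
    rw [div_le_iff₀ hn10]
    nlinarith
  have hK := isCompact_closedCube c hr.le
  set V := volume (closedCube c r) with hV
  have hV0 : V ≠ 0 := volume_closedCube_ne_zero c hr
  have hVt : V ≠ ∞ := hK.measure_lt_top.ne
  have h1 := sobolev_poincare_closedCube hn hf c hr hp'1 hq'0 hrel
  have hvm : Measurable fun x => f x - avgOn (closedCube c r) f :=
    hf.continuous.measurable.sub_const _
  have h2 := eLpNorm'_le_eLpNorm'_mul_rpow_measure_univ (μ := volume.restrict (closedCube c r))
    hq0 hqq' hvm.aestronglyMeasurable
  have h3 := eLpNorm'_le_eLpNorm'_mul_rpow_measure_univ (μ := volume.restrict (closedCube c r))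
    hp'0 hp'p (measurable_upperGrad K f).aestronglyMeasurable
  simp only [eLpNorm', enorm_eq_self, Measure.restrict_apply_univ, ← hV] at h2 h3
  have h4 : ∫⁻ x in closedCube c r, upperGrad K f x ^ p =
      ∫⁻ x in closedCube c r, ‖fderiv ℝ f x‖ₑ ^ p := by
    refine lintegral_congr_ae ?_
    filter_upwards [ae_restrict_of_ae (upperGrad_ae_eq volume hf)] with x hx
    rw [hx]
  rw [h4] at h3
  set G := (∫⁻ x in closedCube c r, ‖fderiv ℝ f x‖ₑ ^ p) ^ (1 / p) with hG
  calc _ ≤ _ := h2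
    _ ≤ ENNReal.ofReal (n * 2 ^ n + q') * (G * V ^ (1 / p' - 1 / p)) * V ^ (1 / q - 1 / q') := by
        gcongr
        exact h1.trans (mul_le_mul_right h3 _)
    _ = ENNReal.ofReal (n * 2 ^ n + q') * V ^ (1 / (n : ℝ) + 1 / q - 1 / p) * G := by
        have : 1 / (n : ℝ) + 1 / q - 1 / p = (1 / p' - 1 / p) + (1 / q - 1 / q') := by
          rw [hrel]; ring
        rw [this, ENNReal.rpow_add _ _ hV0 hVt]
        ring
    _ ≤ _ := by
        gcongr
        have : (0 : ℝ) ≤ n * 2 ^ n := by positivity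
        nlinarith

theorem LocLipschitzOn.exists_lipschitzWith_eqOn {S : Set (Eucl n)} (hS : IsCompact S)
    {f : Eucl n → ℝ} (hf : LocLipschitzOn S f) :
    ∃ (K : ℝ≥0) (F : Eucl n → ℝ), LipschitzWith K F ∧ EqOn f F S := by
  have hloc : LocallyLipschitzOn S f := by
    intro x hx
    obtain ⟨K, t, ht, hKt⟩ := hf x hx
    exact ⟨K, t ∩ S, inter_mem (mem_nhdsWithin_of_mem_nhds ht) self_mem_nhdsWithin, hKt⟩
  obtain ⟨K, hK⟩ := LocallyLipschitzOn.exists_lipschitzOnWith_of_compact hS hloc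
  obtain ⟨F, hF, hfF⟩ := hK.extend_real
  exact ⟨K, F, hF, hfF⟩

theorem gradNorm_ae_eq_of_eqOn {S : Set (Eucl n)} (hS : Convex ℝ S) (hSm : MeasurableSet S)
    {f F : Eucl n → ℝ} (h : EqOn f F S) :
    gradNorm f =ᵐ[volume.restrict S] gradNorm F := by
  have hfr : ∀ᵐ x ∂(volume.restrict S), x ∉ frontier S :=
    ae_restrict_of_ae (measure_eq_zero_iff_ae_notMem.1 (hS.addHaar_frontier volume))
  filter_upwards [hfr, ae_restrict_mem hSm] with x hx hxS
  have hint : x ∈ interior S := by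
    by_contra hni
    exact hx ⟨subset_closure hxS, hni⟩
  have heq : f =ᶠ[𝓝 x] F := Filter.mem_of_superset (mem_interior_iff_mem_nhds.1 hint) h
  simp only [gradNorm, heq.fderiv_eq]

theorem integral_rpow_rpow_eq_toReal {α : Type*} [MeasurableSpace α] {μ : Measure α} {g : α → ℝ}
    (hg : Measurable g) {p : ℝ} (hp : 0 ≤ p) :
    (∫ x, |g x| ^ p ∂μ) ^ (1 / p) = ((∫⁻ x, ‖g x‖ₑ ^ p ∂μ) ^ (1 / p)).toReal := by
  have hm : AEStronglyMeasurable (fun x => |g x| ^ p) μ :=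
    Measurable.aestronglyMeasurable (by fun_prop)
  have h1 := integral_norm_eq_lintegral_enorm hm
  have h2 : ∀ x, ‖|g x| ^ p‖ = |g x| ^ p := fun x => by
    rw [Real.norm_eq_abs, abs_of_nonneg (by positivity)]
  have h3 : ∀ x, ‖|g x| ^ p‖ₑ = ‖g x‖ₑ ^ p := fun x => by
    rw [Real.enorm_rpow_of_nonneg (abs_nonneg _) hp, Real.enorm_abs]
  simp only [h2, h3] at h1
  rw [h1, ENNReal.toReal_rpow]

end Reduction

/-- Lemma 6.3, constant-exponent Sobolev–Poincaré inequality on cubes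
with constant `C(n)·q`. -/
theorem sobolev_poincare_cube_constant_exponent
    (n : ℕ) (hn : 2 ≤ n) :
    ∃ C : ℝ, 0 < C ∧
      ∀ (c : Eucl n) (r : ℝ), 0 < r →
      ∀ p q : ℝ, 1 ≤ p → p < n → p ≤ q → q ≤ n * p / (n - p) →
      ∀ f : Eucl n → ℝ, LocLipschitzOn (closedCube c r) f →
        IntegrableOn f (closedCube c r) volume →
        (∫ x in closedCube c r, |f x - avgOn (closedCube c r) f| ^ q) ^ (1 / q)
          ≤ C * q * (volume (closedCube c r)).toReal ^ (1 / (n:ℝ) + 1 / q - 1 / p)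
            * (∫ x in closedCube c r, gradNorm f x ^ p) ^ (1 / p) := by
  refine ⟨n * 2 ^ n + 2, by positivity, ?_⟩
  intro c r hr p q hp hpn hpq hq f hf _
  have hK := isCompact_closedCube c hr.le
  have hQ := (isClosed_closedCube c r).measurableSet
  have hp0 : 0 < p := by linarith
  have hq0 : 0 < q := by linarith
  obtain ⟨K, F, hF, hfF⟩ := hf.exists_lipschitzWith_eqOn hK
  have havg : avgOn (closedCube c r) f = avgOn (closedCube c r) F := by
    rw [avgOn, avgOn, setIntegral_congr_fun hQ hfF]
  have hleft : ∫ x in closedCube c r, |f x - avgOn (closedCube c r) f| ^ q =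
      ∫ x in closedCube c r, |F x - avgOn (closedCube c r) F| ^ q :=
    setIntegral_congr_fun hQ fun x hx => by simp only [havg, hfF hx]
  have hright : ∫ x in closedCube c r, gradNorm f x ^ p =
      ∫ x in closedCube c r, |‖fderiv ℝ F x‖| ^ p := by
    refine integral_congr_ae ?_
    filter_upwards [gradNorm_ae_eq_of_eqOn (convex_closedCube c r) hQ hfF] with x hx
    rw [hx, gradNorm, abs_norm]
  have hD : Measurable fun x => ‖fderiv ℝ F x‖ := (measurable_fderiv ℝ F).norm
  rw [hleft, hright, integral_rpow_rpow_eq_toReal (hF.continuous.measurable.sub_const _) hq0.le,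
    integral_rpow_rpow_eq_toReal hD hp0.le, ENNReal.toReal_rpow]
  simp only [enorm_norm]
  have hmain := sobolev_poincare_closedCube_of_le hn hF c hr hp hpn hpq hq
  have hfin : ∫⁻ x in closedCube c r, ‖fderiv ℝ F x‖ₑ ^ p ≠ ∞ := by
    refine ne_top_of_le_ne_top (ENNReal.mul_ne_top (ENNReal.rpow_ne_top_of_nonneg hp0.le
      ENNReal.coe_ne_top) hK.measure_lt_top.ne) (b := (K : ℝ≥0∞) ^ p * volume (closedCube c r)) ?_
    rw [← setLIntegral_const]
    refine lintegral_mono fun x => ENNReal.rpow_le_rpow ?_ hp0.le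
    rw [enorm_eq_nnnorm, ENNReal.coe_le_coe]
    exact norm_fderiv_le_of_lipschitz ℝ hF
  have hVt : volume (closedCube c r) ^ (1 / (n : ℝ) + 1 / q - 1 / p) ≠ ∞ :=
    ENNReal.rpow_ne_top_of_ne_zero (volume_closedCube_ne_zero c hr) hK.measure_lt_top.ne
  have hreal := ENNReal.toReal_mono (ENNReal.mul_ne_top
    (ENNReal.mul_ne_top ENNReal.ofReal_ne_top hVt)
    (ENNReal.rpow_ne_top_of_nonneg (by positivity) hfin)) hmain
  rwa [ENNReal.toReal_mul, ENNReal.toReal_mul, ENNReal.toReal_ofReal (by positivity)] at hreal
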